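/- Let 0 < α < 1 and γ ∈ ℝ. Define ψ : (0,∞) → ℝ by ψ(z) = z^{γα} Ψ(−z^{−α}; −α, 1+γα). Then ψ is continuously differentiable on (0,∞), its Riemann–Liouville derivative of order α exists, and for all z > 0: (d^α/dz^α)ψ(z) = −γ ψ(z) + (1/α) z ψ'(z); equivalently, (d^α/dz^α)ψ(z) = z^{(γ−1)α} Ψ(−z^{−α}; −α, 1+(γ−1)α). -/

import Mathlib

open MeasureTheory Real Set

noncomputable section

/-- The Riemann–Liouville kernel: for `α = n` it is `h` itself; for `n - 1 < α < n`
it is the fractional integral of order `n - α` of `h`. -/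
def rlKernel (n : ℕ) (α : ℝ) (h : ℝ → ℝ) : ℝ → ℝ :=
  if α = (n : ℝ) then h
  else fun t => (Real.Gamma ((n : ℝ) - α))⁻¹ *
    ∫ s in (0:ℝ)..t, h s * (t - s) ^ ((n : ℝ) - α - 1)

/-- The Riemann–Liouville fractional derivative of order `α` (with `n - 1 < α ≤ n`). -/
def rlDeriv (n : ℕ) (α : ℝ) (h : ℝ → ℝ) : ℝ → ℝ :=
  iteratedDeriv n (rlKernel n α h)

/-- The Riemann–Liouville derivative of order `α` of `h` exists on `(0, ∞)`. -/
def HasRLDerivOn (n : ℕ) (α : ℝ) (h : ℝ → ℝ) : Prop :=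
  ContDiffOn ℝ n (rlKernel n α h) (Set.Ioi 0)

/-- The Wright function `Ψ(z; ρ, b) = Σ_{k≥0} z^k / (k! Γ(ρk + b))`, with the
convention that `1/Γ` vanishes at the poles of `Γ` (Mathlib's `Real.Gamma` is `0`
there). -/
def wrightFn (z ρ b : ℝ) : ℝ :=
  ∑' k : ℕ, z ^ k / (k.factorial * Real.Gamma (ρ * k + b))

open Filter Topology

theorem integrableOn_rpow_mul_exp_neg_mul {s c : ℝ} (hs : -1 < s) (hc : 0 < c) :
    IntegrableOn (fun r : ℝ => r ^ s * Real.exp (-c * r)) (Ioi 0) := by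
  have := integrableOn_rpow_mul_exp_neg_mul_rpow hs one_pos hc
  simpa only [Real.rpow_one] using this

theorem aestronglyMeasurable_rpow_mul {f : ℝ → ℂ} (s : ℝ) (hf : Measurable f) :
    AEStronglyMeasurable (fun r : ℝ => ((r ^ s : ℝ) : ℂ) * f r)
      (volume.restrict (Ioi (0 : ℝ))) :=
  ((Complex.measurable_ofReal.comp (measurable_id.pow_const s)).mul hf).aestronglyMeasurable

/-- Laplace transform of a power, at a complex frequency. -/
theorem integral_rpow_mul_cexp_neg_mul {x : ℝ} (hx : 0 < x) {w : ℂ} (hw : 0 < w.re) :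
    ∫ r in Ioi (0 : ℝ), ((r ^ (x - 1) : ℝ) : ℂ) * Complex.exp (-w * r)
      = (1 / w) ^ (x : ℂ) * (Real.Gamma x : ℂ) := by
  let U : Set ℂ := {w | 0 < w.re}
  have hU : IsOpen U := isOpen_lt continuous_const Complex.continuous_re
  have hUc : IsPreconnected U := (convex_halfSpace_re_gt 0).isPreconnected
  let f : ℂ → ℂ := fun w => ∫ r in Ioi (0 : ℝ), ((r ^ (x - 1) : ℝ) : ℂ) * Complex.exp (-w * r)
  let g : ℂ → ℂ := fun w => (1 / w) ^ (x : ℂ) * (Real.Gamma x : ℂ)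
  have hf : DifferentiableOn ℂ f U := by
    intro w₀ hw₀
    have hw₀' : 0 < w₀.re := hw₀
    have hs : {w : ℂ | w₀.re / 2 < w.re} ∈ 𝓝 w₀ :=
      (isOpen_lt continuous_const Complex.continuous_re).mem_nhds (by
        simp only [mem_ofPred_eq]; linarith)
    have key := hasDerivAt_integral_of_dominated_loc_of_deriv_le
      (μ := volume.restrict (Ioi (0 : ℝ))) (𝕜 := ℂ)
      (F := fun (w : ℂ) (r : ℝ) => ((r ^ (x - 1) : ℝ) : ℂ) * Complex.exp (-w * r))
      (F' := fun (w : ℂ) (r : ℝ) => ((r ^ (x - 1) : ℝ) : ℂ) * (-r * Complex.exp (-w * r)))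
      (bound := fun r => r ^ x * Real.exp (-(w₀.re / 2) * r)) (x₀ := w₀) hs
      (Eventually.of_forall fun w => aestronglyMeasurable_rpow_mul _ (by fun_prop))
      ?_ (aestronglyMeasurable_rpow_mul _ (by fun_prop)) ?_
      (integrableOn_rpow_mul_exp_neg_mul (by linarith) (by linarith)) ?_
    · exact key.2.differentiableAt.differentiableWithinAt
    · refine (integrableOn_rpow_mul_exp_neg_mul (s := x - 1) (by linarith) hw₀').mono'
        (aestronglyMeasurable_rpow_mul _ (by fun_prop)) ?_
      filter_upwards [ae_restrict_mem measurableSet_Ioi] with r hr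
      rw [norm_mul, Complex.norm_exp, Complex.norm_real, Real.norm_of_nonneg
        (Real.rpow_nonneg (le_of_lt hr) _)]
      simp
    · filter_upwards [ae_restrict_mem measurableSet_Ioi] with r hr w hw
      have hr' : 0 < r := hr
      rw [norm_mul, norm_mul, Complex.norm_exp, Complex.norm_real, Real.norm_of_nonneg
        (Real.rpow_nonneg (le_of_lt hr) _), norm_neg, Complex.norm_real,
        Real.norm_of_nonneg hr'.le, ← mul_assoc, ← Real.rpow_add_one hr'.ne', sub_add_cancel]
      gcongr
      have : w₀.re / 2 < w.re := hw
      simp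
      gcongr
    · filter_upwards with r w hw
      have h1 : HasDerivAt (fun w : ℂ => -w * (r : ℂ)) (-r) w := by
        simpa using ((hasDerivAt_id w).neg.mul_const (r : ℂ))
      have := h1.cexp.const_mul ((r ^ (x - 1) : ℝ) : ℂ)
      convert! this using 1
      ring
  have hg : DifferentiableOn ℂ g U := by
    intro w₀ hw₀
    have hw₀' : 0 < w₀.re := hw₀
    have hne : w₀ ≠ 0 := fun h => by simp [h] at hw₀'
    have h1 : 0 < (1 / w₀).re := by
      rw [one_div, Complex.inv_re]
      exact div_pos hw₀' (Complex.normSq_pos.2 hne)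
    have h2 : DifferentiableAt ℂ (fun w : ℂ => 1 / w) w₀ :=
      (differentiableAt_const _).div differentiableAt_id hne
    exact ((h2.cpow_const (Or.inl h1)).mul_const _).differentiableWithinAt
  have h1U : (1 : ℂ) ∈ U := by simp [U]
  refine (hf.analyticOnNhd hU).eqOn_of_preconnected_of_frequently_eq (hg.analyticOnNhd hU) hUc h1U
    ?_ hw
  have hreal : ∀ c : ℝ, 0 < c → f c = g c := by
    intro c hc
    have := Real.integral_rpow_mul_exp_neg_mul_Ioi hx hc
    simp only [f, g]
    have h2 : ((1 / c : ℂ)) ^ (x : ℂ) = (((1 / c) ^ x : ℝ) : ℂ) := by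
      rw [Complex.ofReal_cpow (by positivity)]; simp
    rw [h2, ← Complex.ofReal_mul, ← this, ← integral_complex_ofReal]
    congr 1
    ext r
    push_cast
    ring_nf
  have ht : Tendsto (fun c : ℝ => (c : ℂ)) (𝓝[≠] 1) (𝓝[≠] 1) := by
    refine tendsto_nhdsWithin_iff.2 ⟨?_, ?_⟩
    · exact (Complex.continuous_ofReal.tendsto' 1 1 (by simp)).mono_left nhdsWithin_le_nhds
    · filter_upwards [self_mem_nhdsWithin] with c hc
      simpa using hc
  refine ht.frequently (Eventually.frequently ?_)
  filter_upwards [mem_nhdsWithin_of_mem_nhds (lt_mem_nhds (zero_lt_one : (0 : ℝ) < 1))] with c hc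
  exact hreal c hc

theorem integrableOn_rpow_mul_exp_rpow_sub {α b : ℝ} (hα0 : 0 < α) (hα1 : α < 1) (hb : b < 1)
    {K c : ℝ} (hK : 0 ≤ K) (hc : 0 < c) :
    IntegrableOn (fun r : ℝ => r ^ (-b) * Real.exp (K * r ^ α - c * r)) (Ioi 0) := by
  obtain ⟨C, hC⟩ : ∃ C : ℝ, ∀ r : ℝ, 0 < r → K * r ^ α ≤ C + c / 2 * r := by
    let D : ℝ := c / (2 * (K + 1))
    have hD : 0 < D := by positivity
    let R : ℝ := D ^ (1 / (α - 1))
    have hR : 0 < R := by positivity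
    have hRD : R ^ (α - 1) = D := by
      rw [← Real.rpow_mul hD.le, one_div_mul_cancel (by linarith), Real.rpow_one]
    have hKD : K * D ≤ c / 2 := by
      have : (K + 1) * D = c / 2 := by simp only [D]; field_simp
      nlinarith
    refine ⟨K * R ^ α, fun r hr => ?_⟩
    have h4 : 0 ≤ K * R ^ α := by positivity
    rcases le_total r R with h | h
    · have h1 := mul_le_mul_of_nonneg_left (Real.rpow_le_rpow hr.le h hα0.le) hK
      have : 0 ≤ c / 2 * r := by positivity
      linarith
    · have h1 : r ^ (α - 1) ≤ D := hRD ▸ Real.rpow_le_rpow_of_nonpos hR h (by linarith)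
      have h2 : r ^ α = r ^ (α - 1) * r := by rw [← Real.rpow_add_one hr.ne', sub_add_cancel]
      have h3 : r ^ α ≤ D * r := by rw [h2]; gcongr
      nlinarith [mul_le_mul_of_nonneg_left h3 hK]
  refine ((integrableOn_rpow_mul_exp_neg_mul (s := -b) (by linarith) (half_pos hc)).const_mul
    (Real.exp C)).mono' (Measurable.aestronglyMeasurable (by fun_prop)) ?_
  filter_upwards [ae_restrict_mem measurableSet_Ioi] with r hr
  have hr' : 0 < r := hr
  rw [norm_mul, Real.norm_of_nonneg (Real.rpow_nonneg hr'.le _), Real.norm_of_nonneg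
    (Real.exp_nonneg _), mul_left_comm, ← Real.exp_add]
  gcongr
  linarith [hC r hr']

/-- The Laplace transform of `r ^ (-b) * exp (-κ * r ^ α)`, expanded termwise. -/
theorem hasSum_integral_rpow_mul_cexp {α b : ℝ} (hα0 : 0 < α) (hα1 : α < 1) (hb : b < 1)
    (κ : ℂ) {w : ℂ} (hw : 0 < w.re) :
    HasSum (fun k : ℕ => (-κ) ^ k / (k.factorial : ℂ) *
        ((1 / w) ^ ((α * k + 1 - b : ℝ) : ℂ) * (Real.Gamma (α * k + 1 - b) : ℂ)))
      (∫ r in Ioi (0 : ℝ), ((r ^ (-b) : ℝ) : ℂ) *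
        Complex.exp (-κ * ((r ^ α : ℝ) : ℂ) - w * r)) := by
  have hx : ∀ k : ℕ, 0 < α * k + 1 - b := fun k => by
    have : 0 ≤ α * k := by positivity
    linarith
  have hbsum : ∀ r : ℝ, HasSum
      (fun k : ℕ => r ^ (-b) * (Real.exp (-w.re * r) * ((‖κ‖ * r ^ α) ^ k / k.factorial)))
      (r ^ (-b) * (Real.exp (-w.re * r) * Real.exp (‖κ‖ * r ^ α))) := fun r => by
    refine HasSum.mul_left _ (HasSum.mul_left _ ?_)
    rw [Real.exp_eq_exp_ℝ]
    exact NormedSpace.expSeries_div_hasSum_exp _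
  have key := hasSum_integral_of_dominated_convergence (μ := volume.restrict (Ioi (0 : ℝ)))
    (F := fun (k : ℕ) (r : ℝ) => ((r ^ (-b) : ℝ) : ℂ) *
      (Complex.exp (-w * r) * ((-κ * ((r ^ α : ℝ) : ℂ)) ^ k / (k.factorial : ℂ))))
    (f := fun r : ℝ => ((r ^ (-b) : ℝ) : ℂ) * Complex.exp (-κ * ((r ^ α : ℝ) : ℂ) - w * r))
    (fun k r => r ^ (-b) * (Real.exp (-w.re * r) * ((‖κ‖ * r ^ α) ^ k / k.factorial)))
    (fun k => aestronglyMeasurable_rpow_mul _ (by fun_prop)) ?_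
    (ae_of_all _ fun r => (hbsum r).summable) ?_ ?_
  · convert! key using 2 with k
    rw [← integral_rpow_mul_cexp_neg_mul (hx k) hw, ← integral_const_mul]
    refine setIntegral_congr_fun measurableSet_Ioi fun r hr => ?_
    have hr' : 0 < r := hr
    have : r ^ (α * k + 1 - b - 1) = r ^ (-b) * (r ^ α) ^ k := by
      rw [← Real.rpow_mul_natCast hr'.le, ← Real.rpow_add hr']
      ring_nf
    simp only [this]
    push_cast
    ring
  · intro k
    filter_upwards [ae_restrict_mem measurableSet_Ioi] with r hr
    have hr' : 0 < r := hr
    simp [Complex.norm_exp, abs_of_nonneg (Real.rpow_nonneg hr'.le _)]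
  · simp_rw [(hbsum _).tsum_eq, ← Real.exp_add]
    refine (integrableOn_rpow_mul_exp_rpow_sub hα0 hα1 hb (norm_nonneg κ) hw).congr_fun
      (fun r _ => ?_) measurableSet_Ioi
    simp only
    ring_nf
  · filter_upwards with r
    have h1 := (NormedSpace.expSeries_div_hasSum_exp (-κ * ((r ^ α : ℝ) : ℂ)))
    rw [← Complex.exp_eq_exp_ℂ] at h1
    have := (h1.mul_left (Complex.exp (-w * r))).mul_left ((r ^ (-b) : ℝ) : ℂ)
    rw [← Complex.exp_add] at this
    convert! this using 3
    ring

theorem pi_mul_inv_Gamma_one_sub {x : ℝ} (hx : 0 < x) :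
    π * (Real.Gamma (1 - x))⁻¹ = Real.Gamma x * Real.sin (π * x) := by
  have h := Real.Gamma_mul_Gamma_one_sub x
  have hG := (Real.Gamma_pos_of_pos hx).ne'
  by_cases hs : Real.sin (π * x) = 0
  · rw [hs, div_zero] at h
    rw [(mul_eq_zero.1 h).resolve_left hG, hs]
    simp
  · have h0 : Real.Gamma (1 - x) ≠ 0 := by
      intro h0
      rw [h0, mul_zero, eq_comm, div_eq_zero_iff] at h
      exact h.elim Real.pi_ne_zero hs
    rw [eq_div_iff hs] at h
    rw [← div_eq_mul_inv, div_eq_iff h0]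
    linarith

theorem abs_inv_Gamma_le {y : ℝ} (hy : y < 1) :
    |(Real.Gamma y)⁻¹| ≤ Real.Gamma (1 - y) := by
  have h := pi_mul_inv_Gamma_one_sub (x := 1 - y) (by linarith)
  rw [sub_sub_cancel] at h
  have hG := Real.Gamma_pos_of_pos (s := 1 - y) (by linarith)
  have h1 : π * |(Real.Gamma y)⁻¹| ≤ Real.Gamma (1 - y) := by
    rw [← abs_of_pos Real.pi_pos, ← abs_mul, h, abs_mul, abs_of_pos hG]
    exact mul_le_of_le_one_right hG.le (Real.abs_sin_le_one _)
  nlinarith [Real.pi_gt_three, abs_nonneg (Real.Gamma y)⁻¹]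

theorem inv_Gamma_eq_self_mul (y : ℝ) :
    (Real.Gamma y)⁻¹ = y * (Real.Gamma (y + 1))⁻¹ := by
  rcases eq_or_ne y 0 with rfl | hy
  · simp [Real.Gamma_zero]
  · rw [Real.Gamma_add_one hy, mul_inv, ← mul_assoc, mul_inv_cancel₀ hy, one_mul]

theorem continuous_inv_Gamma : Continuous fun y : ℝ => (Real.Gamma y)⁻¹ := by
  have h := Complex.continuous_re.comp
    (Complex.differentiable_one_div_Gamma.continuous.comp Complex.continuous_ofReal)
  convert! h using 2 with y
  simp [Complex.Gamma_ofReal, ← Complex.ofReal_inv]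

theorem summable_pow_div_factorial_mul_Gamma {α a : ℝ} (hα0 : 0 < α) (hα1 : α < 1) (ha : 0 < a)
    (x : ℝ) : Summable fun k : ℕ => x ^ k / k.factorial * Real.Gamma (α * k + a) := by
  have h := (hasSum_integral_rpow_mul_cexp hα0 hα1 (b := 1 - a) (by linarith) (-x : ℂ)
    (w := 1) (by simp)).summable
  rw [← Complex.summable_ofReal]
  convert! h using 2 with k
  rw [show α * k + 1 - (1 - a) = α * k + a by ring]
  simp

theorem exists_summable_bound_wrightFn {α : ℝ} (hα0 : 0 < α) (hα1 : α < 1) (B x : ℝ) :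
    ∃ (u : ℕ → ℝ) (N : ℕ), Summable u ∧ ∀ b ∈ Icc (B - 1) B, ∀ k : ℕ,
      ‖x ^ (k + N) / ((k + N).factorial * Real.Gamma (-α * (k + N : ℕ) + b))‖ ≤ u k := by
  obtain ⟨N, hN⟩ := exists_nat_gt (B / α)
  rw [div_lt_iff₀ hα0] at hN
  let a : ℝ := α * N + 1 - B
  have ha : 0 < a := by simp only [a]; linarith
  refine ⟨fun k => |x| ^ N * (|x| ^ k / k.factorial * Real.Gamma (α * k + a)
    + |x| ^ k / k.factorial * Real.Gamma (α * k + (a + 1))), N,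
    ((summable_pow_div_factorial_mul_Gamma hα0 hα1 ha _).add
      (summable_pow_div_factorial_mul_Gamma hα0 hα1 (by linarith) _)).mul_left _, ?_⟩
  rintro b ⟨hb1, hb2⟩ k
  have hk : 0 ≤ α * k := by positivity
  have hp : 0 < α * k + a := by linarith
  have h1 : |(Real.Gamma (-α * (k + N : ℕ) + b))⁻¹|
      ≤ Real.Gamma (α * k + a) + Real.Gamma (α * k + (a + 1)) := by
    refine (abs_inv_Gamma_le (by push_cast; linarith)).trans ?_
    have hmem : 1 - (-α * (k + N : ℕ) + b) ∈ segment ℝ (α * k + a) (α * k + (a + 1)) := by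
      rw [segment_eq_Icc (by linarith)]
      simp only [a]
      push_cast
      constructor <;> linarith
    have := Real.convexOn_Gamma.le_on_segment (x := α * k + a) (y := α * k + (a + 1)) hp
      (by simp only [mem_Ioi]; linarith) hmem
    have g1 := Real.Gamma_pos_of_pos hp
    have g2 := Real.Gamma_pos_of_pos (s := α * k + (a + 1)) (by linarith)
    exact this.trans (max_le (by linarith) (by linarith))
  have h2 : ((k + N).factorial : ℝ)⁻¹ ≤ (k.factorial : ℝ)⁻¹ := by
    gcongr
    omega
  calc ‖x ^ (k + N) / ((k + N).factorial * Real.Gamma (-α * (k + N : ℕ) + b))‖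
      = |x| ^ (k + N) * ((k + N).factorial : ℝ)⁻¹
        * |(Real.Gamma (-α * (k + N : ℕ) + b))⁻¹| := by
        rw [div_eq_mul_inv, mul_inv, Real.norm_eq_abs, abs_mul, abs_mul, abs_pow, ← mul_assoc,
          abs_of_nonneg (a := ((k + N).factorial : ℝ)⁻¹) (by positivity)]
    _ ≤ |x| ^ (k + N) * (k.factorial : ℝ)⁻¹
        * (Real.Gamma (α * k + a) + Real.Gamma (α * k + (a + 1))) := by gcongr
    _ = _ := by ring

theorem summable_wrightFn {α : ℝ} (hα0 : 0 < α) (hα1 : α < 1) (b x : ℝ) :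
    Summable fun k : ℕ => x ^ k / (k.factorial * Real.Gamma (-α * k + b)) := by
  obtain ⟨u, N, hu, h⟩ := exists_summable_bound_wrightFn hα0 hα1 b x
  exact (summable_nat_add_iff N).1
    (Summable.of_norm_bounded hu fun k => h b ⟨by linarith, le_rfl⟩ k)

theorem continuousOn_wrightFn_param {α : ℝ} (hα0 : 0 < α) (hα1 : α < 1) (B x : ℝ) :
    ContinuousOn (fun b => wrightFn x (-α) b) (Icc (B - 1) B) := by
  obtain ⟨u, N, hu, h⟩ := exists_summable_bound_wrightFn hα0 hα1 B x
  have hc : ∀ k : ℕ, Continuous fun b : ℝ => x ^ k / (k.factorial * Real.Gamma (-α * k + b)) := by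
    intro k
    simp_rw [div_eq_mul_inv, mul_inv]
    exact continuous_const.mul (continuous_const.mul
      (continuous_inv_Gamma.comp (by fun_prop)))
  have h1 := continuousOn_tsum (fun k => (hc (k + N)).continuousOn) hu (fun k b hb => h b hb k)
  have h2 : ContinuousOn (fun b : ℝ => ∑ k ∈ Finset.range N,
      x ^ k / (k.factorial * Real.Gamma (-α * k + b))) (Icc (B - 1) B) :=
    (continuous_finsetSum _ fun k _ => hc k).continuousOn
  refine (h2.add h1).congr fun b _ => ?_
  exact ((summable_wrightFn hα0 hα1 b x).sum_add_tsum_nat_add N).symm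

theorem hasSum_wrightFn_deriv {α : ℝ} (hα0 : 0 < α) (hα1 : α < 1) (b x : ℝ) :
    HasSum (fun k : ℕ => k * x ^ (k - 1) / (k.factorial * Real.Gamma (-α * k + b)))
      (wrightFn x (-α) (b - α)) := by
  have h := (summable_wrightFn hα0 hα1 (b - α) x).hasSum
  rw [← hasSum_nat_add_iff' 1]
  simp only [Finset.range_one, Finset.sum_singleton, Nat.cast_zero, zero_mul, zero_div, sub_zero]
  convert! h using 2 with k
  rw [Nat.factorial_succ, Nat.add_sub_cancel,
    show -α * ((k + 1 : ℕ) : ℝ) + b = -α * k + (b - α) by push_cast; ring]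
  have : ((k : ℝ) + 1) ≠ 0 := by positivity
  push_cast
  rw [mul_assoc, mul_div_mul_left _ _ this]

theorem hasDerivAt_wrightFn {α : ℝ} (hα0 : 0 < α) (hα1 : α < 1) (b x : ℝ) :
    HasDerivAt (fun x => wrightFn x (-α) b) (wrightFn x (-α) (b - α)) x := by
  have hu := (hasSum_wrightFn_deriv hα0 hα1 b (|x| + 1)).summable.norm
  have hx : x ∈ Metric.ball (0 : ℝ) (|x| + 1) := by simp
  have := hasDerivAt_tsum_of_isPreconnected
    (g := fun (k : ℕ) (x : ℝ) => x ^ k / (k.factorial * Real.Gamma (-α * k + b)))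
    (g' := fun (k : ℕ) (x : ℝ) => k * x ^ (k - 1) / (k.factorial * Real.Gamma (-α * k + b)))
    hu Metric.isOpen_ball (convex_ball (0 : ℝ) (|x| + 1)).isPreconnected
    (fun k y _ => (hasDerivAt_pow k y).div_const _) ?_ hx (summable_wrightFn hα0 hα1 b x) hx
  · rwa [(hasSum_wrightFn_deriv hα0 hα1 b x).tsum_eq] at this
  · intro k y hy
    have hy' : |y| ≤ |(|x| + 1)| := by
      rw [abs_of_nonneg (a := |x| + 1) (by positivity)]
      exact (by simpa using hy : |y| < |x| + 1).le
    simp only [norm_div, norm_mul, norm_pow, Real.norm_eq_abs]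
    gcongr

theorem wrightFn_sub_one {α : ℝ} (hα0 : 0 < α) (hα1 : α < 1) (b x : ℝ) :
    wrightFn x (-α) (b - 1) = (b - 1) * wrightFn x (-α) b - α * x * wrightFn x (-α) (b - α) := by
  have h1 := (summable_wrightFn hα0 hα1 b x).hasSum.mul_left (b - 1)
  have h2 := (hasSum_wrightFn_deriv hα0 hα1 b x).mul_left (α * x)
  rw [wrightFn]
  refine HasSum.tsum_eq ?_
  convert! h1.sub h2 using 2 with k
  rw [div_eq_mul_inv, mul_inv, inv_Gamma_eq_self_mul,
    show -α * k + (b - 1) + 1 = -α * k + b by ring]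
  rcases k with _ | k
  · simp
  · simp only [Nat.add_sub_cancel, div_eq_mul_inv, mul_inv, pow_succ]
    push_cast
    ring

/-- The function `t ^ (b - 1) * Ψ(-t ^ (-α); -α, b)`, whose Laplace transform is
`s ^ (-b) * exp (-s ^ α)`. -/
def wrightKernel (α b t : ℝ) : ℝ := t ^ (b - 1) * wrightFn (-t ^ (-α)) (-α) b

theorem wrightKernel_recurrence {α : ℝ} (hα0 : 0 < α) (hα1 : α < 1) (b : ℝ) {t : ℝ} (ht : 0 < t) :
    t * wrightKernel α (b - 1) t = (b - 1) * wrightKernel α b t + α * wrightKernel α (b - α) t := by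
  have e1 : t ^ (b - 1) = t * t ^ (b - 1 - 1) := by
    rw [mul_comm, ← Real.rpow_add_one ht.ne', sub_add_cancel]
  have e2 : t ^ (b - α - 1) = t ^ (b - 1) * t ^ (-α) := by
    rw [← Real.rpow_add ht]; ring_nf
  simp only [wrightKernel, wrightFn_sub_one hα0 hα1 b, e2]
  rw [e1]
  ring

theorem hasDerivAt_wrightKernel {α : ℝ} (hα0 : 0 < α) (hα1 : α < 1) (b : ℝ) {t : ℝ} (ht : 0 < t) :
    HasDerivAt (wrightKernel α b) (wrightKernel α (b - 1) t) t := by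
  have h1 := Real.hasDerivAt_rpow_const (x := t) (p := b - 1) (Or.inl ht.ne')
  have h2 := (Real.hasDerivAt_rpow_const (x := t) (p := -α) (Or.inl ht.ne')).neg
  have h3 := (hasDerivAt_wrightFn hα0 hα1 b (-t ^ (-α))).comp t h2
  have h4 := h1.mul h3
  refine h4.congr_deriv ?_
  have e1 : t ^ (b - 1) = t * t ^ (b - 1 - 1) := by
    rw [mul_comm, ← Real.rpow_add_one ht.ne', sub_add_cancel]
  have e2 : t ^ (-α) = t * t ^ (-α - 1) := by
    rw [mul_comm, ← Real.rpow_add_one ht.ne', sub_add_cancel]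
  simp only [wrightKernel, wrightFn_sub_one hα0 hα1 b, Function.comp, Pi.neg_apply]
  rw [e1, e2]
  ring

theorem one_div_polar_cpow {τ η : ℝ} (hτ : 0 < τ) (h1 : -π < η) (h2 : η ≤ π) (x : ℝ) :
    (1 / ((τ : ℂ) * Complex.exp (-(η * Complex.I)))) ^ (x : ℂ)
      = ((τ ^ (-x) : ℝ) : ℂ) * Complex.exp (((η * x : ℝ) : ℂ) * Complex.I) := by
  have e : 1 / ((τ : ℂ) * Complex.exp (-(η * Complex.I)))
      = Complex.exp (((-Real.log τ : ℝ) : ℂ) + η * Complex.I) := by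
    rw [Complex.exp_add, ← Complex.ofReal_exp, Real.exp_neg, Real.exp_log hτ, Complex.exp_neg,
      one_div, mul_inv, inv_inv, Complex.ofReal_inv]
  rw [e, Complex.cpow_def_of_ne_zero (Complex.exp_ne_zero _), Complex.log_exp (by simpa using h1)
    (by simpa using h2), Real.rpow_def_of_pos hτ, Complex.ofReal_exp, ← Complex.exp_add]
  congr 1
  push_cast
  ring

/-- Termwise expansion of the integral of `s ^ (-b) * exp (-s ^ α)` against an exponential along
the ray of argument `θ`. -/
theorem hasSum_im_ray_integral {α b : ℝ} (hα0 : 0 < α) (hα1 : α < 1) (hb : b < 1) {τ : ℝ}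
    (hτ : 0 < τ) (θ : ℝ) {η : ℝ} (h1 : -π < η) (h2 : η ≤ π) (hη : 0 < Real.cos η) :
    HasSum (fun k : ℕ => (-1) ^ k / (k.factorial : ℝ) * (Real.Gamma (α * k + 1 - b) *
        τ ^ (-(α * k + 1 - b)) * Real.sin ((θ + η) * (α * k + 1 - b))))
      (Complex.exp (((θ * (1 - b) : ℝ) : ℂ) * Complex.I) *
        ∫ r in Ioi (0 : ℝ), ((r ^ (-b) : ℝ) : ℂ) *
          Complex.exp (-Complex.exp (((α * θ : ℝ) : ℂ) * Complex.I) * ((r ^ α : ℝ) : ℂ)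
            - (τ : ℂ) * Complex.exp (-(η * Complex.I)) * r)).im := by
  have hw : 0 < ((τ : ℂ) * Complex.exp (-(η * Complex.I))).re := by
    rw [← neg_mul, ← Complex.ofReal_neg, Complex.re_ofReal_mul, Complex.exp_ofReal_mul_I_re,
      Real.cos_neg]
    positivity
  have h := (hasSum_integral_rpow_mul_cexp hα0 hα1 hb
    (Complex.exp (((α * θ : ℝ) : ℂ) * Complex.I)) hw).mul_left
    (Complex.exp (((θ * (1 - b) : ℝ) : ℂ) * Complex.I))
  have h' := Complex.hasSum_im h
  convert! h' using 2 with k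
  rw [one_div_polar_cpow hτ h1 h2, neg_pow (Complex.exp _), ← Complex.exp_nat_mul]
  have e : Complex.exp (((θ * (1 - b) : ℝ) : ℂ) * Complex.I) *
      ((-1) ^ k * Complex.exp (k * (((α * θ : ℝ) : ℂ) * Complex.I)) / (k.factorial : ℂ) *
        (((τ ^ (-(α * k + 1 - b)) : ℝ) : ℂ) *
          Complex.exp (((η * (α * k + 1 - b) : ℝ) : ℂ) * Complex.I) *
          (Real.Gamma (α * k + 1 - b) : ℂ)))
      = (((-1) ^ k / (k.factorial : ℝ) * (Real.Gamma (α * k + 1 - b) *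
        τ ^ (-(α * k + 1 - b))) : ℝ) : ℂ) *
        Complex.exp ((((θ + η) * (α * k + 1 - b) : ℝ) : ℂ) * Complex.I) := by
    have e1 : Complex.exp ((((θ + η) * (α * k + 1 - b) : ℝ) : ℂ) * Complex.I)
        = Complex.exp (((θ * (1 - b) : ℝ) : ℂ) * Complex.I) *
          Complex.exp (k * (((α * θ : ℝ) : ℂ) * Complex.I)) *
          Complex.exp (((η * (α * k + 1 - b) : ℝ) : ℂ) * Complex.I) := by
      rw [← Complex.exp_add, ← Complex.exp_add]
      congr 1
      push_cast
      ring
    rw [e1]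
    push_cast
    ring
  rw [e, Complex.im_ofReal_mul, Complex.exp_ofReal_mul_I_im]
  ring

/-- The boundary value on the imaginary axis of `s ^ (-b) * exp (-s ^ α)`, integrated over the
positive half-axis against `exp (s * t)`. -/
def wrightFourier (α b t : ℝ) : ℂ :=
  ∫ r in Ioi (0 : ℝ), ((r ^ (-b) : ℝ) : ℂ) *
    Complex.exp (-Complex.exp (((α * (π / 2) : ℝ) : ℂ) * Complex.I) * ((r ^ α : ℝ) : ℂ)
      + ((t * r : ℝ) : ℂ) * Complex.I)

theorem cos_mul_pi_div_two_pos {α : ℝ} (hα0 : 0 < α) (hα1 : α < 1) :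
    0 < Real.cos (α * (π / 2)) :=
  Real.cos_pos_of_mem_Ioo ⟨by nlinarith [Real.pi_pos], by nlinarith [Real.pi_pos]⟩

theorem tendsto_im_ray_integral {α b : ℝ} (hα0 : 0 < α) (hα1 : α < 1) (hb : b < 1) (t : ℝ)
    {l : Filter ℝ} [l.IsCountablyGenerated] (hl : l ≤ 𝓝 (π / 2))
    (hlt : ∀ᶠ θ in l, t * Real.cos θ ≤ 0) :
    Tendsto (fun θ : ℝ => (Complex.exp (((θ * (1 - b) : ℝ) : ℂ) * Complex.I) *
        ∫ r in Ioi (0 : ℝ), ((r ^ (-b) : ℝ) : ℂ) *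
          Complex.exp (-Complex.exp (((α * θ : ℝ) : ℂ) * Complex.I) * ((r ^ α : ℝ) : ℂ)
            + (t : ℂ) * Complex.exp (θ * Complex.I) * r)).im) l
      (𝓝 (Complex.exp (((π / 2 * (1 - b) : ℝ) : ℂ) * Complex.I) * wrightFourier α b t).im) := by
  have hc := cos_mul_pi_div_two_pos hα0 hα1
  have hev : ∀ᶠ θ in l, Real.cos (α * (π / 2)) / 2 < Real.cos (α * θ) := by
    have : Continuous fun θ : ℝ => Real.cos (α * θ) := by fun_prop
    exact hl (this.continuousAt.eventually (lt_mem_nhds (by linarith)))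
  refine (Complex.continuous_im.tendsto _).comp (Tendsto.mul ?_ ?_)
  · have : Continuous fun θ : ℝ => Complex.exp (((θ * (1 - b) : ℝ) : ℂ) * Complex.I) := by
      fun_prop
    exact (this.tendsto _).mono_left hl
  · refine tendsto_integral_filter_of_dominated_convergence
      (fun r => r ^ (-b) * Real.exp (-(Real.cos (α * (π / 2)) / 2) * r ^ α))
      (Eventually.of_forall fun θ => aestronglyMeasurable_rpow_mul _ (by fun_prop)) ?_
      (integrableOn_rpow_mul_exp_neg_mul_rpow (by linarith) hα0 (by linarith)) ?_
    · filter_upwards [hev, hlt] with θ h1 h2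
      filter_upwards [ae_restrict_mem measurableSet_Ioi] with r hr
      have hr' : 0 < r := hr
      rw [norm_mul, Complex.norm_exp, Complex.norm_real, Real.norm_of_nonneg
        (Real.rpow_nonneg hr'.le _)]
      gcongr
      rw [Complex.add_re, Complex.re_mul_ofReal, Complex.re_mul_ofReal, Complex.re_ofReal_mul,
        Complex.neg_re, Complex.exp_ofReal_mul_I_re,
        Complex.exp_ofReal_mul_I_re]
      have h3 : 0 < r ^ α := by positivity
      nlinarith [mul_le_mul_of_nonneg_right h1.le h3.le, mul_nonneg (neg_nonneg.2 h2) hr'.le]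
    · filter_upwards with r
      refine Tendsto.mono_left ?_ hl
      have : Continuous fun θ : ℝ => ((r ^ (-b) : ℝ) : ℂ) *
          Complex.exp (-Complex.exp (((α * θ : ℝ) : ℂ) * Complex.I) * ((r ^ α : ℝ) : ℂ)
            + (t : ℂ) * Complex.exp (θ * Complex.I) * r) := by fun_prop
      refine this.tendsto' _ _ ?_
      rw [show Complex.exp (((π / 2 : ℝ) : ℂ) * Complex.I) = Complex.I by
        push_cast; exact Complex.exp_pi_div_two_mul_I]
      push_cast
      ring_nf

theorem im_wrightFourier_of_pos {α b : ℝ} (hα0 : 0 < α) (hα1 : α < 1) (hb : b < 1) {t : ℝ}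
    (ht : 0 < t) :
    (Complex.exp (((π / 2 * (1 - b) : ℝ) : ℂ) * Complex.I) * wrightFourier α b t).im
      = π * wrightKernel α b t := by
  have hmem : Ioo (π / 2) π ∈ 𝓝[>] (π / 2) := Ioo_mem_nhdsGT (by linarith [Real.pi_pos])
  have hcos : ∀ θ ∈ Ioo (π / 2) π, Real.cos θ < 0 := fun θ hθ =>
    Real.cos_neg_of_pi_div_two_lt_of_lt hθ.1 (by linarith [hθ.2, Real.pi_pos])
  have hlim := tendsto_im_ray_integral hα0 hα1 hb t (l := 𝓝[>] (π / 2)) nhdsWithin_le_nhds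
    (by filter_upwards [hmem] with θ hθ using (mul_neg_of_pos_of_neg ht (hcos θ hθ)).le)
  refine tendsto_nhds_unique hlim (tendsto_const_nhds.congr' ?_)
  filter_upwards [hmem] with θ hθ
  have hsum := hasSum_im_ray_integral hα0 hα1 hb ht θ (η := π - θ)
    (by linarith [hθ.2, Real.pi_pos]) (by linarith [hθ.1, Real.pi_pos])
    (by rw [Real.cos_pi_sub]; linarith [hcos θ hθ])
  have hexp : Complex.exp (-(((π - θ : ℝ) : ℂ) * Complex.I)) = -Complex.exp (θ * Complex.I) := by
    rw [show -(((π - θ : ℝ) : ℂ) * Complex.I) = θ * Complex.I - π * Complex.I by push_cast; ring,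
      Complex.exp_sub, Complex.exp_pi_mul_I, div_neg, div_one]
  simp only [hexp, mul_neg, neg_mul, sub_neg_eq_add] at hsum
  simp only [neg_mul]
  refine HasSum.unique ?_ hsum
  have hk := ((summable_wrightFn hα0 hα1 b (-t ^ (-α))).hasSum.mul_left (t ^ (b - 1))).mul_left π
  simp only [neg_mul] at hk
  simp only [wrightKernel, wrightFn, neg_mul]
  convert! hk using 2 with k
  · have hx : 0 < α * k + 1 - b := by
      have : 0 ≤ α * k := by positivity
      linarith
    have hG := pi_mul_inv_Gamma_one_sub hx
    have e1 : t ^ (-(α * k + 1 - b)) = t ^ (b - 1) * (t ^ (-α)) ^ k := by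
      rw [← Real.rpow_mul_natCast ht.le, ← Real.rpow_add ht]
      ring_nf
    rw [add_sub_cancel, e1, show -(α * k) + b = 1 - (α * k + 1 - b) by ring, neg_pow (t ^ (-α)),
      div_eq_mul_inv (_ * _), mul_inv]
    calc _ = (-1) ^ k / (k.factorial : ℝ) * (t ^ (b - 1) * (t ^ (-α)) ^ k) *
          (Real.Gamma (α * k + 1 - b) * Real.sin (π * (α * k + 1 - b))) := by ring
      _ = _ := by rw [← hG]; ring

theorem im_wrightFourier_of_neg {α b : ℝ} (hα0 : 0 < α) (hα1 : α < 1) (hb : b < 1) {t : ℝ}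
    (ht : t < 0) :
    (Complex.exp (((π / 2 * (1 - b) : ℝ) : ℂ) * Complex.I) * wrightFourier α b t).im = 0 := by
  have hmem : Ioo 0 (π / 2) ∈ 𝓝[<] (π / 2) := Ioo_mem_nhdsLT (by linarith [Real.pi_pos])
  have hcos : ∀ θ ∈ Ioo 0 (π / 2), 0 < Real.cos θ := fun θ hθ =>
    Real.cos_pos_of_mem_Ioo ⟨by linarith [hθ.1, Real.pi_pos], hθ.2⟩
  have hlim := tendsto_im_ray_integral hα0 hα1 hb t (l := 𝓝[<] (π / 2)) nhdsWithin_le_nhds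
    (by filter_upwards [hmem] with θ hθ using (mul_neg_of_neg_of_pos ht (hcos θ hθ)).le)
  refine tendsto_nhds_unique hlim (tendsto_const_nhds.congr' ?_)
  filter_upwards [hmem] with θ hθ
  have hsum := hasSum_im_ray_integral hα0 hα1 hb (neg_pos.2 ht) θ (η := -θ)
    (by linarith [hθ.2, Real.pi_pos]) (by linarith [hθ.1, Real.pi_pos])
    (by rw [Real.cos_neg]; exact hcos θ hθ)
  simp only [add_neg_cancel, zero_mul, Real.sin_zero, mul_zero, Complex.ofReal_neg, neg_mul,
    neg_neg, sub_neg_eq_add] at hsum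
  simp only [neg_mul]
  exact HasSum.unique hasSum_zero hsum

theorem norm_wrightFourier_integrand {α : ℝ} (b t : ℝ) {r : ℝ} (hr : 0 < r) :
    ‖((r ^ (-b) : ℝ) : ℂ) *
      Complex.exp (-Complex.exp (((α * (π / 2) : ℝ) : ℂ) * Complex.I) * ((r ^ α : ℝ) : ℂ)
        + ((t * r : ℝ) : ℂ) * Complex.I)‖
      = r ^ (-b) * Real.exp (-Real.cos (α * (π / 2)) * r ^ α) := by
  rw [norm_mul, Complex.norm_exp, Complex.norm_real, Real.norm_of_nonneg
    (Real.rpow_nonneg hr.le _), Complex.add_re, Complex.re_mul_ofReal, Complex.neg_re,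
    Complex.exp_ofReal_mul_I_re, Complex.re_ofReal_mul, Complex.I_re, mul_zero, add_zero]

theorem integrableOn_wrightFourier_majorant {α b : ℝ} (hα0 : 0 < α) (hα1 : α < 1) (hb : b < 1) :
    IntegrableOn (fun r : ℝ => r ^ (-b) * Real.exp (-Real.cos (α * (π / 2)) * r ^ α)) (Ioi 0) :=
  integrableOn_rpow_mul_exp_neg_mul_rpow (by linarith) hα0 (cos_mul_pi_div_two_pos hα0 hα1)

theorem continuous_wrightFourier {α b : ℝ} (hα0 : 0 < α) (hα1 : α < 1) (hb : b < 1) :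
    Continuous (wrightFourier α b) := by
  refine continuous_of_dominated (fun t => aestronglyMeasurable_rpow_mul _ (by fun_prop))
    (fun t => ?_) (integrableOn_wrightFourier_majorant hα0 hα1 hb)
    (ae_of_all _ fun r => by fun_prop)
  filter_upwards [ae_restrict_mem measurableSet_Ioi] with r hr
  exact (norm_wrightFourier_integrand b t hr).le

/-- The kernel `wrightKernel`, extended by zero to the negative half-axis. -/
def causalWright (α b t : ℝ) : ℝ := if 0 < t then wrightKernel α b t else 0

theorem causalWright_of_pos {α b t : ℝ} (ht : 0 < t) :
    causalWright α b t = wrightKernel α b t := if_pos ht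

theorem causalWright_of_nonpos {α b t : ℝ} (ht : t ≤ 0) : causalWright α b t = 0 :=
  if_neg ht.not_gt

theorem pi_mul_causalWright {α b : ℝ} (hα0 : 0 < α) (hα1 : α < 1) (hb : b < 1) (t : ℝ) :
    π * causalWright α b t
      = (Complex.exp (((π / 2 * (1 - b) : ℝ) : ℂ) * Complex.I) * wrightFourier α b t).im := by
  rcases lt_trichotomy t 0 with ht | rfl | ht
  · rw [causalWright_of_nonpos ht.le, im_wrightFourier_of_neg hα0 hα1 hb ht, mul_zero]
  · have hc : Continuous fun t => (Complex.exp (((π / 2 * (1 - b) : ℝ) : ℂ) * Complex.I) *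
        wrightFourier α b t).im :=
      Complex.continuous_im.comp (continuous_const.mul (continuous_wrightFourier hα0 hα1 hb))
    have h1 := (hc.tendsto 0).mono_left (nhdsWithin_le_nhds (s := Iio 0))
    rw [causalWright_of_nonpos le_rfl, mul_zero]
    refine tendsto_nhds_unique (tendsto_const_nhds.congr' ?_) h1
    filter_upwards [self_mem_nhdsWithin] with t ht
    exact (im_wrightFourier_of_neg hα0 hα1 hb ht).symm
  · rw [causalWright_of_pos ht, im_wrightFourier_of_pos hα0 hα1 hb ht]

theorem norm_wrightFourier_le {α b : ℝ} (hα0 : 0 < α) (hα1 : α < 1) (hb : b < 1) (t : ℝ) :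
    ‖wrightFourier α b t‖
      ≤ ∫ r in Ioi (0 : ℝ), r ^ (-b) * Real.exp (-Real.cos (α * (π / 2)) * r ^ α) := by
  refine norm_integral_le_of_norm_le (integrableOn_wrightFourier_majorant hα0 hα1 hb) ?_
  filter_upwards [ae_restrict_mem measurableSet_Ioi] with r hr
  exact (norm_wrightFourier_integrand b t hr).le

theorem abs_causalWright_le {α b : ℝ} (hα0 : 0 < α) (hα1 : α < 1) (hb : b < 1) (t : ℝ) :
    |causalWright α b t|
      ≤ ∫ r in Ioi (0 : ℝ), r ^ (-b) * Real.exp (-Real.cos (α * (π / 2)) * r ^ α) := by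
  have h1 : π * |causalWright α b t| ≤ ‖wrightFourier α b t‖ := by
    rw [← abs_of_pos Real.pi_pos, ← abs_mul, pi_mul_causalWright hα0 hα1 hb]
    refine (Complex.abs_im_le_norm _).trans ?_
    rw [norm_mul, Complex.norm_exp_ofReal_mul_I, one_mul]
  have h2 := norm_wrightFourier_le hα0 hα1 hb t
  nlinarith [Real.pi_gt_three, abs_nonneg (causalWright α b t)]

theorem exists_abs_causalWright_le {α B : ℝ} (hα0 : 0 < α) (hα1 : α < 1) (hB : B < 1) :
    ∃ M : ℝ, ∀ b ∈ Icc 0 B, ∀ t, |causalWright α b t| ≤ M := by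
  have hi0 := integrableOn_wrightFourier_majorant hα0 hα1 (b := 0) one_pos
  have hiB := integrableOn_wrightFourier_majorant hα0 hα1 hB
  refine ⟨_, fun b hb t => (abs_causalWright_le hα0 hα1 (hb.2.trans_lt hB) t).trans
    (setIntegral_mono_on (integrableOn_wrightFourier_majorant hα0 hα1 (hb.2.trans_lt hB))
      (hi0.add hiB) measurableSet_Ioi fun r hr => ?_)⟩
  have hr' : 0 < r := hr
  simp only [Pi.add_apply, ← add_mul]
  gcongr
  rcases le_total r 1 with h | h
  · have := Real.rpow_le_rpow_of_exponent_ge hr' h (neg_le_neg hb.2)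
    have := Real.rpow_nonneg hr'.le (-0)
    linarith
  · have := Real.rpow_le_rpow_of_exponent_le h (neg_le_neg hb.1)
    have := Real.rpow_nonneg hr'.le (-B)
    linarith

theorem tendsto_wrightKernel_zero_of_lt_one {α b : ℝ} (hα0 : 0 < α) (hα1 : α < 1) (hb : b < 1) :
    Tendsto (wrightKernel α b) (𝓝[>] 0) (𝓝 0) := by
  have hc : Continuous (causalWright α b) := by
    have h : causalWright α b = fun t => π⁻¹ *
        (Complex.exp (((π / 2 * (1 - b) : ℝ) : ℂ) * Complex.I) * wrightFourier α b t).im := by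
      ext t
      rw [← pi_mul_causalWright hα0 hα1 hb, inv_mul_cancel_left₀ Real.pi_ne_zero]
    rw [h]
    exact continuous_const.mul
      (Complex.continuous_im.comp (continuous_const.mul (continuous_wrightFourier hα0 hα1 hb)))
  have h1 := (hc.tendsto 0).mono_left (nhdsWithin_le_nhds (s := Ioi 0))
  rw [causalWright_of_nonpos le_rfl] at h1
  refine h1.congr' ?_
  filter_upwards [self_mem_nhdsWithin] with t ht
  exact causalWright_of_pos ht

theorem tendsto_wrightKernel_zero_of_shifts {α b : ℝ} (hα0 : 0 < α) (hα1 : α < 1) (hb : b ≠ 1)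
    (h1 : Tendsto (wrightKernel α (b - 1)) (𝓝[>] 0) (𝓝 0))
    (h2 : Tendsto (wrightKernel α (b - α)) (𝓝[>] 0) (𝓝 0)) :
    Tendsto (wrightKernel α b) (𝓝[>] 0) (𝓝 0) := by
  have hid : Tendsto (fun t : ℝ => t) (𝓝[>] 0) (𝓝 0) := nhdsWithin_le_nhds
  have h := ((hid.mul h1).sub (h2.const_mul α)).div_const (b - 1)
  simp only [mul_zero, sub_zero, zero_div] at h
  refine h.congr' ?_
  filter_upwards [self_mem_nhdsWithin] with t ht
  rw [wrightKernel_recurrence hα0 hα1 b ht, add_sub_cancel_right,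
    mul_div_cancel_left₀ _ (sub_ne_zero.2 hb)]

theorem tendsto_wrightKernel_one_zero {α : ℝ} (hα0 : 0 < α) (hα1 : α < 1) :
    Tendsto (wrightKernel α 1) (𝓝[>] 0) (𝓝 0) := by
  obtain ⟨M, hM⟩ := exists_abs_causalWright_le hα0 hα1 (B := α) hα1
  have hlip : ∀ b ∈ Ioo 1 (1 + α), ∀ t, 0 < t → |wrightKernel α b t| ≤ M * t := by
    intro b hb t ht
    have h0 := tendsto_wrightKernel_zero_of_shifts hα0 hα1 hb.1.ne'
      (tendsto_wrightKernel_zero_of_lt_one hα0 hα1 (by linarith [hb.2]))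
      (tendsto_wrightKernel_zero_of_lt_one hα0 hα1 (by linarith [hb.2]))
    have h1 : Tendsto (fun s => |wrightKernel α b t - wrightKernel α b s|) (𝓝[>] 0)
        (𝓝 |wrightKernel α b t|) := by
      simpa using (tendsto_const_nhds.sub h0).abs
    have h2 : Tendsto (fun s : ℝ => M * |t - s|) (𝓝[>] 0) (𝓝 (M * t)) := by
      have : Continuous fun s : ℝ => M * |t - s| := by fun_prop
      refine (this.tendsto' 0 (M * t) ?_).mono_left nhdsWithin_le_nhds
      rw [sub_zero, abs_of_pos ht]
    refine le_of_tendsto_of_tendsto h1 h2 ?_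
    filter_upwards [self_mem_nhdsWithin] with s hs
    refine (convex_Ioi (0 : ℝ)).norm_image_sub_le_of_norm_hasDerivWithin_le
      (f := wrightKernel α b) (f' := wrightKernel α (b - 1))
      (fun u hu => (hasDerivAt_wrightKernel hα0 hα1 b hu).hasDerivWithinAt) (fun u hu => ?_) hs ht
    rw [← causalWright_of_pos hu]
    exact hM _ ⟨by linarith [hb.1], by linarith [hb.2]⟩ u
  have hone : ∀ t, 0 < t → |wrightKernel α 1 t| ≤ M * t := by
    intro t ht
    have hc : ContinuousOn (fun b => wrightKernel α b t) (Icc (2 - 1) 2) := by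
      refine ContinuousOn.mul ?_ (continuousOn_wrightFn_param hα0 hα1 2 _)
      exact (Real.continuous_const_rpow ht.ne').comp_continuousOn (by fun_prop)
    have h1 : Tendsto (fun b => wrightKernel α b t) (𝓝[>] 1) (𝓝 (wrightKernel α 1 t)) := by
      refine (hc 1 (by norm_num)).mono_left ?_
      rw [← nhdsWithin_Ioo_eq_nhdsGT (show (1 : ℝ) < 2 by norm_num)]
      refine nhdsWithin_mono _ fun x hx => ⟨by linarith [hx.1], hx.2.le⟩
    refine le_of_tendsto h1.abs ?_
    filter_upwards [Ioo_mem_nhdsGT (show (1 : ℝ) < 1 + α by linarith)] with b hb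
    exact hlip b hb t ht
  have hlim : Tendsto (fun t : ℝ => M * t) (𝓝[>] 0) (𝓝 0) := by
    have : Continuous fun t : ℝ => M * t := by fun_prop
    exact (this.tendsto' 0 0 (by simp)).mono_left nhdsWithin_le_nhds
  refine squeeze_zero_norm' ?_ hlim
  filter_upwards [self_mem_nhdsWithin] with t ht using hone t ht

/-- The kernel vanishes at the origin, for every value of its second parameter. -/
theorem tendsto_wrightKernel_zero {α : ℝ} (hα0 : 0 < α) (hα1 : α < 1) (b : ℝ) :
    Tendsto (wrightKernel α b) (𝓝[>] 0) (𝓝 0) := by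
  have h : ∀ (n : ℕ) (b : ℝ), b < 1 + n * α → Tendsto (wrightKernel α b) (𝓝[>] 0) (𝓝 0) := by
    intro n
    induction n with
    | zero => exact fun b hb => tendsto_wrightKernel_zero_of_lt_one hα0 hα1 (by simpa using hb)
    | succ n ih =>
      intro b hb
      push_cast at hb
      rcases eq_or_ne b 1 with rfl | hb1
      · exact tendsto_wrightKernel_one_zero hα0 hα1
      · exact tendsto_wrightKernel_zero_of_shifts hα0 hα1 hb1 (ih _ (by linarith))
          (ih _ (by linarith))
  obtain ⟨n, hn⟩ := exists_nat_gt ((b - 1) / α)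
  rw [div_lt_iff₀ hα0] at hn
  exact h n b (by linarith)

theorem continuous_causalWright {α : ℝ} (hα0 : 0 < α) (hα1 : α < 1) (b : ℝ) :
    Continuous (causalWright α b) := by
  refine continuous_iff_continuousAt.2 fun t => ?_
  rcases lt_trichotomy t 0 with ht | rfl | ht
  · refine continuousAt_const.congr (f := fun _ => (0 : ℝ)) ?_
    filter_upwards [gt_mem_nhds ht] with s hs
    exact (causalWright_of_nonpos hs.le).symm
  · rw [continuousAt_iff_continuous_left'_right']
    unfold ContinuousWithinAt
    rw [causalWright_of_nonpos le_rfl]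
    constructor
    · refine tendsto_const_nhds.congr' ?_
      filter_upwards [self_mem_nhdsWithin] with s hs
      exact (causalWright_of_nonpos (le_of_lt hs)).symm
    · refine (tendsto_wrightKernel_zero hα0 hα1 b).congr' ?_
      filter_upwards [self_mem_nhdsWithin] with s hs
      exact (causalWright_of_pos hs).symm
  · refine (hasDerivAt_wrightKernel hα0 hα1 b ht).continuousAt.congr ?_
    filter_upwards [lt_mem_nhds ht] with s hs
    exact (causalWright_of_pos hs).symm

theorem hasDerivAt_causalWright {α : ℝ} (hα0 : 0 < α) (hα1 : α < 1) (b t : ℝ) :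
    HasDerivAt (causalWright α b) (causalWright α (b - 1) t) t := by
  refine hasDerivAt_of_hasDerivAt_of_ne' (x := 0) (fun t ht => ?_)
    (continuous_causalWright hα0 hα1 b).continuousAt
    (continuous_causalWright hα0 hα1 (b - 1)).continuousAt t
  rcases lt_or_gt_of_ne ht with ht | ht
  · rw [causalWright_of_nonpos ht.le]
    refine (hasDerivAt_const t (0 : ℝ)).congr_of_eventuallyEq ?_
    filter_upwards [gt_mem_nhds ht] with s hs
    exact causalWright_of_nonpos hs.le
  · rw [causalWright_of_pos ht]
    refine (hasDerivAt_wrightKernel hα0 hα1 b ht).congr_of_eventuallyEq ?_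
    filter_upwards [lt_mem_nhds ht] with s hs
    exact causalWright_of_pos hs

theorem integral_rpow_mul_cexp_mul_wrightFourier {α b ε : ℝ} (hα0 : 0 < α) (hα1 : α < 1)
    (hb : b < 1) (hε : 0 < ε) (t : ℝ) :
    ∫ v in Ioi (0 : ℝ), ((v ^ (1 - α - 1) : ℝ) : ℂ) * Complex.exp (-(ε : ℂ) * v) *
        wrightFourier α b (t - v)
      = ∫ r in Ioi (0 : ℝ), ((r ^ (-b) : ℝ) : ℂ) *
        Complex.exp (-Complex.exp (((α * (π / 2) : ℝ) : ℂ) * Complex.I) * ((r ^ α : ℝ) : ℂ)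
          + ((t * r : ℝ) : ℂ) * Complex.I) *
        ((1 / ((ε : ℂ) + r * Complex.I)) ^ ((1 - α : ℝ) : ℂ) * (Real.Gamma (1 - α) : ℂ)) := by
  unfold wrightFourier
  simp_rw [← integral_const_mul]
  rw [integral_integral_swap]
  · refine integral_congr_ae (ae_of_all _ fun r => ?_)
    have hw : 0 < ((ε : ℂ) + r * Complex.I).re := by simpa using hε
    dsimp only
    rw [← integral_rpow_mul_cexp_neg_mul (by linarith) hw, ← integral_const_mul]
    refine integral_congr_ae (ae_of_all _ fun v => ?_)
    have e : Complex.exp (-(ε : ℂ) * v) *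
        Complex.exp (-Complex.exp (((α * (π / 2) : ℝ) : ℂ) * Complex.I) * ((r ^ α : ℝ) : ℂ)
          + (((t - v) * r : ℝ) : ℂ) * Complex.I)
        = Complex.exp (-Complex.exp (((α * (π / 2) : ℝ) : ℂ) * Complex.I) * ((r ^ α : ℝ) : ℂ)
          + ((t * r : ℝ) : ℂ) * Complex.I) * Complex.exp (-((ε : ℂ) + r * Complex.I) * v) := by
      rw [← Complex.exp_add, ← Complex.exp_add]
      congr 1
      push_cast
      ring
    linear_combination ((v ^ (1 - α - 1) : ℝ) : ℂ) * ((r ^ (-b) : ℝ) : ℂ) * e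
  · have hm := (integrableOn_rpow_mul_exp_neg_mul (s := 1 - α - 1) (by linarith) hε).mul_prod
      (integrableOn_wrightFourier_majorant hα0 hα1 hb)
    refine hm.mono' (Measurable.aestronglyMeasurable (by unfold Function.uncurry; fun_prop)) ?_
    rw [Measure.prod_restrict]
    filter_upwards [ae_restrict_mem (measurableSet_Ioi.prod measurableSet_Ioi)] with p hp
    have h1 : 0 < p.1 := hp.1
    rw [Function.uncurry, norm_mul, norm_wrightFourier_integrand b _ hp.2, norm_mul,
      Complex.norm_exp, Complex.norm_real, Real.norm_of_nonneg (Real.rpow_nonneg h1.le _),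
      Complex.re_mul_ofReal, Complex.neg_re, Complex.ofReal_re]

theorem norm_one_div_add_mul_I_cpow_le {ε r x : ℝ} (hε : 0 < ε) (hr : 0 < r) (hx : 0 ≤ x) :
    ‖(1 / ((ε : ℂ) + r * Complex.I)) ^ (x : ℂ)‖ ≤ r ^ (-x) := by
  have h0 : (ε : ℂ) + r * Complex.I ≠ 0 := fun h => by
    have := congrArg Complex.re h
    simp at this
    exact hε.ne' this
  rw [Complex.norm_cpow_real, norm_div, norm_one, Real.rpow_neg hr.le, ← Real.inv_rpow hr.le,
    one_div]
  gcongr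
  simpa [abs_of_pos hr] using Complex.abs_im_le_norm ((ε : ℂ) + r * Complex.I)

theorem tendsto_one_div_add_mul_I_cpow {r : ℝ} (hr : 0 < r) (x : ℝ) :
    Tendsto (fun ε : ℝ => (1 / ((ε : ℂ) + r * Complex.I)) ^ (x : ℂ)) (𝓝[>] 0)
      (𝓝 (((r ^ (-x) : ℝ) : ℂ) * Complex.exp (((-(π / 2) * x : ℝ) : ℂ) * Complex.I))) := by
  rw [← one_div_polar_cpow hr (by linarith [Real.pi_pos]) (by linarith [Real.pi_pos])]
  have e : (r : ℂ) * Complex.exp (-(((-(π / 2) : ℝ) : ℂ) * Complex.I))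
      = ((0 : ℝ) : ℂ) + r * Complex.I := by
    push_cast
    rw [neg_mul, neg_neg, Complex.exp_pi_div_two_mul_I, zero_add]
  rw [e]
  have hne : ((0 : ℝ) : ℂ) + r * Complex.I ≠ 0 := by simp [hr.ne']
  have hs : 1 / (((0 : ℝ) : ℂ) + r * Complex.I) ∈ Complex.slitPlane := by
    refine Or.inr ?_
    simp [hr.ne']
  have hc : ContinuousAt (fun ε : ℝ => (1 / ((ε : ℂ) + r * Complex.I)) ^ (x : ℂ)) 0 := by
    refine ContinuousAt.cpow (ContinuousAt.div continuousAt_const (by fun_prop) hne)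
      continuousAt_const hs
  exact hc.tendsto.mono_left nhdsWithin_le_nhds

theorem integrableOn_Ioc_rpow_mul_causalWright {α : ℝ} (hα0 : 0 < α) (hα1 : α < 1) (b t : ℝ)
    {T : ℝ} (hT : 0 ≤ T) :
    IntegrableOn (fun v : ℝ => v ^ (1 - α - 1) * causalWright α b (t - v)) (Ioc 0 T) := by
  rw [← intervalIntegrable_iff_integrableOn_Ioc_of_le hT]
  exact (intervalIntegral.intervalIntegrable_rpow' (by linarith)).mul_continuousOn
    ((continuous_causalWright hα0 hα1 b).comp (by fun_prop)).continuousOn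

theorem rpow_mul_causalWright_eq_zero {α b t T v : ℝ} (htT : t ≤ T)
    (hv : v ∈ Ioi 0 \ Ioc 0 T) : v ^ (1 - α - 1) * causalWright α b (t - v) = 0 := by
  have : T < v := by
    by_contra! h
    exact hv.2 ⟨hv.1, h⟩
  rw [causalWright_of_nonpos (by linarith), mul_zero]

theorem integrableOn_rpow_mul_causalWright {α : ℝ} (hα0 : 0 < α) (hα1 : α < 1) (b t : ℝ) :
    IntegrableOn (fun v : ℝ => v ^ (1 - α - 1) * causalWright α b (t - v)) (Ioi 0) :=
  (integrableOn_Ioc_rpow_mul_causalWright hα0 hα1 b t (abs_nonneg t)).of_forall_sdiff_eq_zero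
    measurableSet_Ioi fun _ hv => rpow_mul_causalWright_eq_zero (le_abs_self t) hv

/-- The convolution of `causalWright α b` with the power `v ^ (-α)`. -/
def wrightConv (α b t : ℝ) : ℝ :=
  ∫ v in Ioi (0 : ℝ), v ^ (1 - α - 1) * causalWright α b (t - v)

theorem wrightConv_eq_setIntegral_Ioc {α b t T : ℝ} (htT : t ≤ T) :
    wrightConv α b t = ∫ v in Ioc 0 T, v ^ (1 - α - 1) * causalWright α b (t - v) :=
  setIntegral_eq_of_subset_of_forall_sdiff_eq_zero measurableSet_Ioi Ioc_subset_Ioi_self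
    fun _ hv => rpow_mul_causalWright_eq_zero htT hv

theorem wrightConv_zero (α b : ℝ) : wrightConv α b 0 = 0 := by
  rw [wrightConv_eq_setIntegral_Ioc le_rfl, Ioc_self, setIntegral_empty]

theorem tendsto_regularized_wrightConv {α : ℝ} (hα0 : 0 < α) (hα1 : α < 1) (b t : ℝ) :
    Tendsto (fun ε : ℝ => ∫ v in Ioi (0 : ℝ), v ^ (1 - α - 1) * Real.exp (-ε * v) *
      causalWright α b (t - v)) (𝓝[>] 0) (𝓝 (wrightConv α b t)) := by
  have hi := integrableOn_rpow_mul_causalWright hα0 hα1 b t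
  refine tendsto_integral_filter_of_dominated_convergence _ (Eventually.of_forall fun ε => ?_) ?_
    hi.norm (ae_of_all _ fun v => ?_)
  · exact (((measurable_id.pow_const _).mul (by fun_prop)).mul
      ((continuous_causalWright hα0 hα1 b).comp (by fun_prop)).measurable).aestronglyMeasurable
  · filter_upwards [self_mem_nhdsWithin] with ε hε
    filter_upwards [ae_restrict_mem measurableSet_Ioi] with v hv
    have hε' : 0 < ε := hε
    have hv' : 0 < v := hv
    have h1 : Real.exp (-ε * v) ≤ 1 := Real.exp_le_one_iff.2 (by nlinarith)
    rw [mul_right_comm, norm_mul, Real.norm_of_nonneg (Real.exp_pos _).le]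
    exact mul_le_of_le_one_right (norm_nonneg _) h1
  · have hc : Continuous fun ε : ℝ => v ^ (1 - α - 1) * Real.exp (-ε * v) *
        causalWright α b (t - v) := by fun_prop
    exact (hc.tendsto' 0 _ (by simp)).mono_left nhdsWithin_le_nhds

theorem pi_mul_regularized_wrightConv {α b ε : ℝ} (hα0 : 0 < α) (hα1 : α < 1) (hb : b < 1)
    (hε : 0 < ε) (t : ℝ) :
    π * ∫ v in Ioi (0 : ℝ), v ^ (1 - α - 1) * Real.exp (-ε * v) * causalWright α b (t - v)
      = (Complex.exp (((π / 2 * (1 - b) : ℝ) : ℂ) * Complex.I) *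
        ∫ v in Ioi (0 : ℝ), ((v ^ (1 - α - 1) : ℝ) : ℂ) * Complex.exp (-(ε : ℂ) * v) *
          wrightFourier α b (t - v)).im := by
  have hi : IntegrableOn (fun v : ℝ => ((v ^ (1 - α - 1) : ℝ) : ℂ) * Complex.exp (-(ε : ℂ) * v) *
      wrightFourier α b (t - v)) (Ioi 0) := by
    refine ((integrableOn_rpow_mul_exp_neg_mul (s := 1 - α - 1) (by linarith) hε).mul_const
      (∫ r in Ioi (0 : ℝ), r ^ (-b) * Real.exp (-Real.cos (α * (π / 2)) * r ^ α))).mono' ?_ ?_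
    · simp_rw [mul_assoc]
      exact aestronglyMeasurable_rpow_mul _ ((by fun_prop : Measurable fun v : ℝ =>
        Complex.exp (-(ε : ℂ) * v)).mul
          ((continuous_wrightFourier hα0 hα1 hb).comp (by fun_prop)).measurable)
    · filter_upwards [ae_restrict_mem measurableSet_Ioi] with v hv
      rw [norm_mul, norm_mul, Complex.norm_exp, Complex.norm_real,
        Real.norm_of_nonneg (Real.rpow_nonneg (le_of_lt hv) _),
        Complex.re_mul_ofReal, Complex.neg_re, Complex.ofReal_re]
      have hv' : 0 < v := hv
      gcongr
      exact norm_wrightFourier_le hα0 hα1 hb _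
  rw [← integral_const_mul, ← integral_const_mul]
  refine Eq.trans ?_ (integral_im (hi.const_mul _))
  refine integral_congr_ae (ae_of_all _ fun v => ?_)
  have e : Complex.exp (((π / 2 * (1 - b) : ℝ) : ℂ) * Complex.I) *
      (((v ^ (1 - α - 1) : ℝ) : ℂ) * Complex.exp (-(ε : ℂ) * v) * wrightFourier α b (t - v))
      = ((v ^ (1 - α - 1) * Real.exp (-ε * v) : ℝ) : ℂ) *
        (Complex.exp (((π / 2 * (1 - b) : ℝ) : ℂ) * Complex.I) * wrightFourier α b (t - v)) := by
    push_cast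
    ring
  simp only [e, RCLike.im_to_complex, Complex.im_ofReal_mul]
  rw [← pi_mul_causalWright hα0 hα1 hb]
  ring

theorem wrightConv_eq_of_lt {α b : ℝ} (hα0 : 0 < α) (hα1 : α < 1) (hb : b < α) (t : ℝ) :
    wrightConv α b t = Real.Gamma (1 - α) * causalWright α (b + 1 - α) t := by
  have hb1 : b < 1 := hb.trans hα1
  have h1 := (tendsto_regularized_wrightConv hα0 hα1 b t).const_mul π
  have h2 : Tendsto (fun ε : ℝ => ∫ r in Ioi (0 : ℝ), ((r ^ (-b) : ℝ) : ℂ) *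
        Complex.exp (-Complex.exp (((α * (π / 2) : ℝ) : ℂ) * Complex.I) * ((r ^ α : ℝ) : ℂ)
          + ((t * r : ℝ) : ℂ) * Complex.I) *
        ((1 / ((ε : ℂ) + r * Complex.I)) ^ ((1 - α : ℝ) : ℂ) * (Real.Gamma (1 - α) : ℂ))) (𝓝[>] 0)
      (𝓝 (∫ r in Ioi (0 : ℝ), ((r ^ (-b) : ℝ) : ℂ) *
        Complex.exp (-Complex.exp (((α * (π / 2) : ℝ) : ℂ) * Complex.I) * ((r ^ α : ℝ) : ℂ)
          + ((t * r : ℝ) : ℂ) * Complex.I) *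
        ((((r ^ (-(1 - α)) : ℝ) : ℂ) * Complex.exp (((-(π / 2) * (1 - α) : ℝ) : ℂ) * Complex.I)) *
          (Real.Gamma (1 - α) : ℂ)))) := by
    refine tendsto_integral_filter_of_dominated_convergence
      (fun r => r ^ (-(b + 1 - α)) * Real.exp (-Real.cos (α * (π / 2)) * r ^ α) *
        Real.Gamma (1 - α)) (Eventually.of_forall fun ε => ?_) ?_
      ((integrableOn_wrightFourier_majorant hα0 hα1 (by linarith)).mul_const _) ?_
    · exact Measurable.aestronglyMeasurable (by fun_prop)
    · filter_upwards [self_mem_nhdsWithin] with ε hε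
      filter_upwards [ae_restrict_mem measurableSet_Ioi] with r hr
      have hr' : 0 < r := hr
      have hG : 0 < Real.Gamma (1 - α) := Real.Gamma_pos_of_pos (by linarith)
      rw [norm_mul, norm_wrightFourier_integrand b t hr', norm_mul, Complex.norm_real,
        Real.norm_of_nonneg hG.le, show -(b + 1 - α) = -b + -(1 - α) by ring,
        Real.rpow_add hr']
      have h := norm_one_div_add_mul_I_cpow_le hε hr' (x := 1 - α) (by linarith)
      calc _ ≤ r ^ (-b) * Real.exp (-Real.cos (α * (π / 2)) * r ^ α) *
            (r ^ (-(1 - α)) * Real.Gamma (1 - α)) := by gcongr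
        _ = _ := by ring
    · filter_upwards [ae_restrict_mem measurableSet_Ioi] with r hr
      exact ((tendsto_one_div_add_mul_I_cpow hr (1 - α)).mul_const _).const_mul _
  have h3 := (Complex.continuous_im.tendsto _).comp
    (h2.const_mul (Complex.exp (((π / 2 * (1 - b) : ℝ) : ℂ) * Complex.I)))
  have h4 := tendsto_nhds_unique (h1.congr' ?_) h3
  swap
  · filter_upwards [self_mem_nhdsWithin] with ε hε
    rw [pi_mul_regularized_wrightConv hα0 hα1 hb1 hε,
      integral_rpow_mul_cexp_mul_wrightFourier hα0 hα1 hb1 hε]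
    rfl
  have e : Complex.exp (((π / 2 * (1 - b) : ℝ) : ℂ) * Complex.I) *
      (∫ r in Ioi (0 : ℝ), ((r ^ (-b) : ℝ) : ℂ) *
        Complex.exp (-Complex.exp (((α * (π / 2) : ℝ) : ℂ) * Complex.I) * ((r ^ α : ℝ) : ℂ)
          + ((t * r : ℝ) : ℂ) * Complex.I) *
        ((((r ^ (-(1 - α)) : ℝ) : ℂ) * Complex.exp (((-(π / 2) * (1 - α) : ℝ) : ℂ) * Complex.I)) *
          (Real.Gamma (1 - α) : ℂ)))
      = (Real.Gamma (1 - α) : ℂ) * (Complex.exp (((π / 2 * (1 - (b + 1 - α)) : ℝ) : ℂ) *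
        Complex.I) * wrightFourier α (b + 1 - α) t) := by
    have e1 : Complex.exp (((π / 2 * (1 - (b + 1 - α)) : ℝ) : ℂ) * Complex.I)
        = Complex.exp (((π / 2 * (1 - b) : ℝ) : ℂ) * Complex.I) *
          Complex.exp (((-(π / 2) * (1 - α) : ℝ) : ℂ) * Complex.I) := by
      rw [← Complex.exp_add]
      congr 1
      push_cast
      ring
    rw [e1, wrightFourier, ← integral_const_mul, ← integral_const_mul, ← integral_const_mul]
    refine setIntegral_congr_fun measurableSet_Ioi fun r hr => ?_
    rw [show -(b + 1 - α) = -b + -(1 - α) by ring, Real.rpow_add hr]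
    push_cast
    ring
  rw [e, Complex.im_ofReal_mul, ← pi_mul_causalWright hα0 hα1 (by linarith)] at h4
  exact mul_left_cancel₀ Real.pi_ne_zero (by rw [h4]; ring)

theorem hasDerivAt_wrightConv {α : ℝ} (hα0 : 0 < α) (hα1 : α < 1) (b t : ℝ) :
    HasDerivAt (wrightConv α b) (wrightConv α (b - 1) t) t := by
  have hT : 0 ≤ |t| + 1 := by positivity
  have hle : ∀ s ∈ Metric.ball t 1, s ≤ |t| + 1 := fun s hs => by
    have := (abs_lt.1 (Metric.mem_ball.1 hs)).2
    linarith [le_abs_self t]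
  obtain ⟨M, hM⟩ := (isCompact_Icc (a := t - 1 - (|t| + 1)) (b := t + 1)).exists_bound_of_continuousOn
    (continuous_causalWright hα0 hα1 (b - 1)).continuousOn
  have hr : IntegrableOn (fun v : ℝ => v ^ (1 - α - 1)) (Ioc 0 (|t| + 1)) := by
    rw [← intervalIntegrable_iff_integrableOn_Ioc_of_le hT]
    exact intervalIntegral.intervalIntegrable_rpow' (by linarith)
  have key := hasDerivAt_integral_of_dominated_loc_of_deriv_le
    (μ := volume.restrict (Ioc 0 (|t| + 1))) (𝕜 := ℝ)
    (F := fun s v : ℝ => v ^ (1 - α - 1) * causalWright α b (s - v))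
    (F' := fun s v : ℝ => v ^ (1 - α - 1) * causalWright α (b - 1) (s - v))
    (bound := fun v => v ^ (1 - α - 1) * M) (Metric.ball_mem_nhds t one_pos)
    (Eventually.of_forall fun s =>
      (integrableOn_Ioc_rpow_mul_causalWright hα0 hα1 b s hT).aestronglyMeasurable)
    (integrableOn_Ioc_rpow_mul_causalWright hα0 hα1 b t hT)
    (integrableOn_Ioc_rpow_mul_causalWright hα0 hα1 (b - 1) t hT).aestronglyMeasurable
    ?_ (hr.mul_const M) (ae_of_all _ fun v s _ => ?_)
  · rw [wrightConv_eq_setIntegral_Ioc (by linarith [le_abs_self t] : t ≤ |t| + 1)]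
    refine key.2.congr_of_eventuallyEq ?_
    filter_upwards [Metric.ball_mem_nhds t one_pos] with s hs
    exact wrightConv_eq_setIntegral_Ioc (hle s hs)
  · filter_upwards [ae_restrict_mem measurableSet_Ioc] with v hv s hs
    have hs' := abs_lt.1 (Metric.mem_ball.1 hs)
    have h0 : 0 ≤ v ^ (1 - α - 1) := Real.rpow_nonneg hv.1.le _
    rw [norm_mul, Real.norm_of_nonneg h0]
    exact mul_le_mul_of_nonneg_left
      (hM _ ⟨by linarith [hs'.1, hv.2], by linarith [hs'.2, hv.1]⟩) h0
  · exact ((hasDerivAt_causalWright hα0 hα1 b (s - v)).comp_sub_const s v).const_mul _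

/-- Fractional integration of order `1 - α` raises the second parameter by `1 - α`. -/
theorem wrightConv_eq {α : ℝ} (hα0 : 0 < α) (hα1 : α < 1) (b t : ℝ) :
    wrightConv α b t = Real.Gamma (1 - α) * causalWright α (b + 1 - α) t := by
  have h : ∀ (n : ℕ) (b : ℝ), b < α + n → ∀ t,
      wrightConv α b t = Real.Gamma (1 - α) * causalWright α (b + 1 - α) t := by
    intro n
    induction n with
    | zero => exact fun b hb => wrightConv_eq_of_lt hα0 hα1 (by simpa using hb)
    | succ n ih =>
      intro b hb t
      push_cast at hb
      have hd : ∀ s, HasDerivAt (fun s => Real.Gamma (1 - α) * causalWright α (b + 1 - α) s)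
          (wrightConv α (b - 1) s) s := fun s => by
        rw [ih (b - 1) (by linarith), show b - 1 + 1 - α = b + 1 - α - 1 by ring]
        exact (hasDerivAt_causalWright hα0 hα1 _ s).const_mul _
      refine isOpen_univ.eqOn_of_deriv_eq isPreconnected_univ
        (fun s _ => (hasDerivAt_wrightConv hα0 hα1 b s).differentiableAt.differentiableWithinAt)
        (fun s _ => (hd s).differentiableAt.differentiableWithinAt) (fun s _ => ?_)
        (mem_univ 0) ?_ (mem_univ t)
      · rw [(hasDerivAt_wrightConv hα0 hα1 b s).deriv, (hd s).deriv]
      · rw [wrightConv_zero, causalWright_of_nonpos le_rfl, mul_zero]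
  obtain ⟨n, hn⟩ := exists_nat_gt (b - α)
  exact h n b (by linarith) t

theorem rlKernel_wrightKernel {α : ℝ} (hα0 : 0 < α) (hα1 : α < 1) (b : ℝ) {t : ℝ} (ht : 0 < t) :
    rlKernel 1 α (wrightKernel α b) t = wrightKernel α (b + 1 - α) t := by
  have e : ∫ s in (0 : ℝ)..t, wrightKernel α b s * (t - s) ^ (1 - α - 1) = wrightConv α b t := by
    have h := intervalIntegral.integral_comp_sub_left (a := 0) (b := t)
      (fun v : ℝ => v ^ (1 - α - 1) * causalWright α b (t - v)) t
    rw [sub_self, sub_zero] at h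
    rw [wrightConv_eq_setIntegral_Ioc le_rfl, ← intervalIntegral.integral_of_le ht.le, ← h]
    refine intervalIntegral.integral_congr_ae (ae_of_all _ fun s hs => ?_)
    rw [uIoc_of_le ht.le] at hs
    rw [sub_sub_cancel, causalWright_of_pos hs.1, mul_comm]
  rw [rlKernel, Nat.cast_one, if_neg hα1.ne, e, wrightConv_eq hα0 hα1, causalWright_of_pos ht,
    inv_mul_cancel_left₀ (Real.Gamma_pos_of_pos (by linarith)).ne']

theorem contDiffOn_one_wrightKernel {α : ℝ} (hα0 : 0 < α) (hα1 : α < 1) (b : ℝ) :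
    ContDiffOn ℝ 1 (wrightKernel α b) (Ioi 0) := by
  rw [contDiffOn_one_iff_derivWithin (uniqueDiffOn_Ioi 0)]
  refine ⟨fun t ht => (hasDerivAt_wrightKernel hα0 hα1 b ht).differentiableAt.differentiableWithinAt,
    ContinuousOn.congr (f := wrightKernel α (b - 1)) (fun t ht =>
      (hasDerivAt_wrightKernel hα0 hα1 _ ht).continuousAt.continuousWithinAt) fun t ht => ?_⟩
  exact (hasDerivAt_wrightKernel hα0 hα1 b ht).hasDerivWithinAt.derivWithin
    (uniqueDiffOn_Ioi 0 t ht)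

/-- For `0 < α < 1` and `γ ∈ ℝ`, the function
`ψ(z) = z^{γα} Ψ(−z^{−α}; −α, 1+γα)` is continuously differentiable on `(0,∞)`,
its Riemann–Liouville derivative of order `α` exists, and satisfies
`dᵅψ/dzᵅ = −γ ψ + (1/α) z ψ'`, equivalently
`dᵅψ/dzᵅ = z^{(γ−1)α} Ψ(−z^{−α}; −α, 1+(γ−1)α)`. -/
theorem wright_key_identity
    (α : ℝ) (hα0 : 0 < α) (hα1 : α < 1) (γ : ℝ)
    (ψ : ℝ → ℝ)
    (hψ : ∀ z, ψ z = z ^ (γ * α) * wrightFn (-z ^ (-α)) (-α) (1 + γ * α)) :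
    ContDiffOn ℝ 1 ψ (Set.Ioi 0) ∧
    HasRLDerivOn 1 α ψ ∧
    (∀ z ∈ Set.Ioi (0:ℝ),
      rlDeriv 1 α ψ z = -γ * ψ z + 1 / α * z * deriv ψ z ∧
      rlDeriv 1 α ψ z
        = z ^ ((γ - 1) * α) * wrightFn (-z ^ (-α)) (-α) (1 + (γ - 1) * α)) := by
  obtain rfl : ψ = wrightKernel α (1 + γ * α) := by
    ext z
    rw [hψ, wrightKernel, add_sub_cancel_left]
  have hd : ∀ z ∈ Ioi (0 : ℝ), rlDeriv 1 α (wrightKernel α (1 + γ * α)) z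
      = wrightKernel α (1 + γ * α - α) z := by
    intro z hz
    rw [rlDeriv, iteratedDeriv_one]
    refine HasDerivAt.deriv ?_
    have h := hasDerivAt_wrightKernel hα0 hα1 (1 + γ * α + 1 - α) hz
    rw [show 1 + γ * α + 1 - α - 1 = 1 + γ * α - α by ring] at h
    refine h.congr_of_eventuallyEq ?_
    filter_upwards [Ioi_mem_nhds hz] with t ht
    exact rlKernel_wrightKernel hα0 hα1 _ ht
  refine ⟨contDiffOn_one_wrightKernel hα0 hα1 _, ?_, fun z hz => ⟨?_, ?_⟩⟩
  · rw [HasRLDerivOn, Nat.cast_one]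
    exact (contDiffOn_one_wrightKernel hα0 hα1 _).congr fun t ht =>
      rlKernel_wrightKernel hα0 hα1 _ ht
  · rw [hd z hz, (hasDerivAt_wrightKernel hα0 hα1 _ hz).deriv]
    have h := wrightKernel_recurrence hα0 hα1 (1 + γ * α) hz
    field_simp
    linarith
  · rw [hd z hz, wrightKernel, show 1 + γ * α - α = 1 + (γ - 1) * α by ring, add_sub_cancel_left]
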